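/- Under the stated setting, assume conditions (3.3), (3.4), (3.5) hold for constants M, R, K, ω, δ > 0, and let k : ℝⁿ → ℝ be any locally bounded function with k(0) = 0. Then there exist r̃ > 0 and μ > 0 such that: for every sampling schedule with MASP r̃, every measurable d : [0,∞) → D, and every solution (x,y) of the closed-loop system (3.7) with x(0)'Px(0) < R² and |y(0) + c'x(0)| ≤ ω⁻¹, the function V(t) := (M/2)(y(t) + c'x(t))² + (1/2)x(t)'Px(t) satisfies V̇(t) ≤ −μV(t) for almost every t ≥ 0. -/

import Mathlib

open Matrix MeasureTheory Set Filter

noncomputable section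

/-- The `m × m` matrix with ones on the subdiagonal and zeros elsewhere. -/
def matA (m : ℕ) : Matrix (Fin m) (Fin m) ℝ :=
  Matrix.of fun i j => if (i : ℕ) = (j : ℕ) + 1 then 1 else 0

/-- The vector `b = (1,0,…,0)'` as a plain function. -/
def vecbf (m : ℕ) : Fin m → ℝ := fun i => if (i : ℕ) = 0 then 1 else 0

/-- The vector `b = (1,0,…,0)'` in Euclidean space. -/
def vecb (m : ℕ) : EuclideanSpace ℝ (Fin m) := (WithLp.equiv 2 (Fin m → ℝ)).symm (vecbf m)

/-- View a Euclidean vector as a plain function. -/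
def ef {m : ℕ} (x : EuclideanSpace ℝ (Fin m)) : Fin m → ℝ := x

/-- Matrix-vector multiplication on Euclidean space. -/
def mulVecE {m : ℕ} (M : Matrix (Fin m) (Fin m) ℝ) (x : EuclideanSpace ℝ (Fin m)) :
    EuclideanSpace ℝ (Fin m) :=
  (WithLp.equiv 2 (Fin m → ℝ)).symm (M.mulVec (ef x))

/-- Euclidean inner product `x'y`. -/
def ip {m : ℕ} (x y : EuclideanSpace ℝ (Fin m)) : ℝ := ∑ i, x i * y i

/-- Quadratic form `x'Px`. -/
def qf {m : ℕ} (P : Matrix (Fin m) (Fin m) ℝ) (x : EuclideanSpace ℝ (Fin m)) : ℝ :=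
  ip x (mulVecE P x)

/-- The saturation function `sat(s) = s / max(1,|s|)`. -/
def sat (s : ℝ) : ℝ := s / max 1 |s|

/-- The vector `c = -(A' + pb')⁻¹ (0,…,0,1)'`. -/
def cvec (n : ℕ) (p : EuclideanSpace ℝ (Fin (n+1))) : EuclideanSpace ℝ (Fin (n+1)) :=
  (WithLp.equiv 2 (Fin (n+1) → ℝ)).symm
    (-((((matA (n+1))ᵀ + vecMulVec (ef p) (vecbf (n+1)))⁻¹).mulVec (Pi.single (Fin.last n) 1)))

/-- Condition (3.3): `x'P(Ax + f(d,x,u) + bu) < 0` whenever `d ∈ D`, `x'Px = R²` and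
`|u - p'x| ≤ K|c'b|`. -/
def Cond33 {l n : ℕ} (D : Set (EuclideanSpace ℝ (Fin l)))
    (f : EuclideanSpace ℝ (Fin l) → EuclideanSpace ℝ (Fin (n+1)) → ℝ → EuclideanSpace ℝ (Fin (n+1)))
    (P : Matrix (Fin (n+1)) (Fin (n+1)) ℝ) (p : EuclideanSpace ℝ (Fin (n+1))) (R K : ℝ) : Prop :=
  ∀ d ∈ D, ∀ x : EuclideanSpace ℝ (Fin (n+1)), ∀ u : ℝ,
    qf P x = R ^ 2 → |u - ip p x| ≤ K * |ip (cvec n p) (vecb (n+1))| →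
      ip x (mulVecE P (mulVecE (matA (n+1)) x + f d x u + u • vecb (n+1))) < 0

/-- Condition (3.4): `|g(d,x,u) + c'f(d,x,u)| < K(c'b)²` whenever `d ∈ D`, `x'Px ≤ R²` and
`|u - p'x| ≤ K|c'b|`. -/
def Cond34 {l n : ℕ} (D : Set (EuclideanSpace ℝ (Fin l)))
    (f : EuclideanSpace ℝ (Fin l) → EuclideanSpace ℝ (Fin (n+1)) → ℝ → EuclideanSpace ℝ (Fin (n+1)))
    (g : EuclideanSpace ℝ (Fin l) → EuclideanSpace ℝ (Fin (n+1)) → ℝ → ℝ)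
    (P : Matrix (Fin (n+1)) (Fin (n+1)) ℝ) (p : EuclideanSpace ℝ (Fin (n+1))) (R K : ℝ) : Prop :=
  ∀ d ∈ D, ∀ x : EuclideanSpace ℝ (Fin (n+1)), ∀ u : ℝ,
    qf P x ≤ R ^ 2 → |u - ip p x| ≤ K * |ip (cvec n p) (vecb (n+1))| →
      |g d x u + ip (cvec n p) (f d x u)| < K * (ip (cvec n p) (vecb (n+1))) ^ 2

/-- Condition (3.5). -/
def Cond35 {l n : ℕ} (D : Set (EuclideanSpace ℝ (Fin l)))
    (f : EuclideanSpace ℝ (Fin l) → EuclideanSpace ℝ (Fin (n+1)) → ℝ → EuclideanSpace ℝ (Fin (n+1)))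
    (g : EuclideanSpace ℝ (Fin l) → EuclideanSpace ℝ (Fin (n+1)) → ℝ → ℝ)
    (P : Matrix (Fin (n+1)) (Fin (n+1)) ℝ) (p : EuclideanSpace ℝ (Fin (n+1)))
    (M R K ω δ : ℝ) : Prop :=
  ∀ d ∈ D, ∀ x : EuclideanSpace ℝ (Fin (n+1)), ∀ z : ℝ,
    qf P x ≤ R ^ 2 → ω * |z| ≤ 1 →
      ∀ u : ℝ, u = ip p x - K * ip (cvec n p) (vecb (n+1)) * ω * z →
        z * (M * g d x u + M * ip (cvec n p) (f d x u)
              - K * ip (cvec n p) (vecb (n+1)) * ω * ip (vecb (n+1)) (mulVecE P x))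
          ≤ (M * K * (ip (cvec n p) (vecb (n+1))) ^ 2 * ω - δ) * z ^ 2
            - ip x (mulVecE P
                (mulVecE (matA (n+1) + vecMulVec (vecbf (n+1)) (ef p) + δ • 1) x + f d x u))

/-- A sampling schedule with maximum allowable sampling period `r`. -/
def Sched (r : ℝ) (τ : ℕ → ℝ) : Prop :=
  τ 0 = 0 ∧ (∀ i, 0 < τ (i+1) - τ i) ∧ (∀ i, τ (i+1) - τ i ≤ r) ∧
    Tendsto τ atTop atTop

open Classical in
/-- The hybrid feedback `k̃` of (3.6). -/
def ktilde {n : ℕ} (k : EuclideanSpace ℝ (Fin (n+1)) → ℝ)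
    (P : Matrix (Fin (n+1)) (Fin (n+1)) ℝ) (p : EuclideanSpace ℝ (Fin (n+1)))
    (R K ω : ℝ) (x : EuclideanSpace ℝ (Fin (n+1))) (y : ℝ) : ℝ :=
  if R ^ 2 ≤ qf P x then k x
  else ip p x - K * ip (cvec n p) (vecb (n+1)) * sat (ω * (y + ip (cvec n p) x))

/-- A (locally absolutely continuous) solution of the closed-loop sampled-data system (3.7)
with feedback `fb`, sampling times `τ` and disturbance `d`. -/
def Sol37 {l n : ℕ}
    (f : EuclideanSpace ℝ (Fin l) → EuclideanSpace ℝ (Fin (n+1)) → ℝ → EuclideanSpace ℝ (Fin (n+1)))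
    (g : EuclideanSpace ℝ (Fin l) → EuclideanSpace ℝ (Fin (n+1)) → ℝ → ℝ)
    (fb : EuclideanSpace ℝ (Fin (n+1)) → ℝ → ℝ) (τ : ℕ → ℝ)
    (d : ℝ → EuclideanSpace ℝ (Fin l))
    (x : ℝ → EuclideanSpace ℝ (Fin (n+1))) (y : ℝ → ℝ) : Prop :=
  ∃ (x' : ℝ → EuclideanSpace ℝ (Fin (n+1))) (y' : ℝ → ℝ),
    (∀ T : ℝ, IntervalIntegrable x' volume 0 T) ∧
    (∀ T : ℝ, IntervalIntegrable y' volume 0 T) ∧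
    (∀ t : ℝ, 0 ≤ t → x t = x 0 + ∫ s in (0:ℝ)..t, x' s) ∧
    (∀ t : ℝ, 0 ≤ t → y t = y 0 + ∫ s in (0:ℝ)..t, y' s) ∧
    ∀ i : ℕ, ∀ᵐ t ∂(volume.restrict (Ico (τ i) (τ (i+1)))),
      x' t = mulVecE (matA (n+1)) (x t) + f (d t) (x t) (fb (x (τ i)) (y (τ i)))
          + fb (x (τ i)) (y (τ i)) • vecb (n+1) ∧
      y' t = x t (Fin.last n) + g (d t) (x t) (fb (x (τ i)) (y (τ i)))

lemma intervalIntegrable_clm_comp {G H : Type*} [NormedAddCommGroup G] [NormedSpace ℝ G]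
    [NormedAddCommGroup H] [NormedSpace ℝ H] (T : G →L[ℝ] H) {φ : ℝ → G} {a b : ℝ}
    (hφ : IntervalIntegrable φ volume a b) :
    IntervalIntegrable (fun s => T (φ s)) volume a b :=
  ⟨T.integrable_comp hφ.1, T.integrable_comp hφ.2⟩

section SampledArcs

variable {X E : Type*} [NormedAddCommGroup E] [NormedSpace ℝ E]

/-- On `[a, b]`, the function `w` is absolutely continuous with derivative `w'`, and solves
`w' = F (d t) (w t) (w a)`: the argument sampled at time `a` is kept constant on `[a, b]`. -/
structure SampledArc (D : Set X) (F : X → E → E → E) (a b : ℝ) (d : ℝ → X) (w w' : ℝ → E) :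
    Prop where
  mem : ∀ t, d t ∈ D
  le : a ≤ b
  integrable : IntervalIntegrable w' volume a b
  eq_integral : ∀ t ∈ Icc a b, w t = w a + ∫ s in a..t, w' s
  ae_eq : ∀ᵐ t, t ∈ Ioc a b → w' t = F (d t) (w t) (w a)

namespace SampledArc

variable {D : Set X} {F : X → E → E → E} {a b : ℝ} {d : ℝ → X} {w w' : ℝ → E}

lemma integrable_left (h : SampledArc D F a b d w w') {t : ℝ} (ht : t ∈ Icc a b) :
    IntervalIntegrable w' volume a t :=
  h.integrable.mono_set (by
    rw [uIcc_of_le ht.1, uIcc_of_le h.le]; exact Icc_subset_Icc_right ht.2)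

lemma continuousOn (h : SampledArc D F a b d w w') : ContinuousOn w (Icc a b) := by
  have h1 : ContinuousOn (fun t => w a + ∫ s in a..t, w' s) (Icc a b) := by
    refine continuousOn_const.add ?_
    have := intervalIntegral.continuousOn_primitive_interval (μ := volume) (f := w')
      (a := a) (b := b) (by
        rw [uIcc_of_le h.le, integrableOn_Icc_iff_integrableOn_Ioc]
        exact h.integrable.1)
    rwa [uIcc_of_le h.le] at this
  exact h1.congr h.eq_integral

lemma norm_sub_le (h : SampledArc D F a b d w w') {C t : ℝ} (ht : t ∈ Icc a b)
    (hC : ∀ s ∈ Ico a t, ∀ e ∈ D, ‖F e (w s) (w a)‖ ≤ C) : ‖w t - w a‖ ≤ C * (t - a) := by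
  rw [h.eq_integral t ht, add_sub_cancel_left, ← abs_of_nonneg (sub_nonneg.2 ht.1)]
  apply intervalIntegral.norm_integral_le_of_norm_le_const_ae
  have hne : ∀ᵐ s : ℝ, s ≠ t := by simp [ae_iff, measure_singleton]
  filter_upwards [h.ae_eq, hne] with s hs hst hmem
  rw [uIoc_of_le ht.1] at hmem
  rw [hs ⟨hmem.1, hmem.2.trans ht.2⟩]
  exact hC s ⟨hmem.1.le, lt_of_le_of_ne hmem.2 hst⟩ _ (h.mem s)

lemma norm_sub_lt_one (h : SampledArc D F a b d w w') {C : ℝ}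
    (hCb : C * (b - a) < 1) (hC0 : 0 ≤ C)
    (hC : ∀ v, ‖v - w a‖ < 1 → ∀ e ∈ D, ‖F e v (w a)‖ ≤ C) :
    ∀ t ∈ Icc a b, ‖w t - w a‖ < 1 := by
  by_contra! hcon
  have hcont : ContinuousOn (fun t => ‖w t - w a‖) (Icc a b) :=
    (h.continuousOn.sub continuousOn_const).norm
  have hcpt : IsCompact (Icc a b ∩ (fun t => ‖w t - w a‖) ⁻¹' Ici 1) :=
    isCompact_Icc.of_isClosed_subset
      (hcont.preimage_isClosed_of_isClosed isClosed_Icc isClosed_Ici) inter_subset_left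
  obtain ⟨t, ht, hmin⟩ := hcpt.exists_isLeast (by
    obtain ⟨t, ht, h1⟩ := hcon
    exact ⟨t, ht, h1⟩)
  have h1 : ‖w t - w a‖ ≤ C * (t - a) := by
    refine h.norm_sub_le ht.1 fun s hs => hC _ ?_
    by_contra! h2
    exact absurd (hmin ⟨⟨hs.1, hs.2.le.trans ht.1.2⟩, h2⟩) (not_le.2 hs.2)
  have h2 : C * (t - a) ≤ C * (b - a) := by gcongr; exact ht.1.2
  have h3 : 1 ≤ ‖w t - w a‖ := ht.2
  linarith

/-- Over a short sampling interval, the state moves by at most a small multiple of its norm. -/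
lemma exists_norm_sub_le [NormedAddCommGroup X] [ProperSpace E] (hD : IsCompact D) {S : Set E} (hS : IsCompact S)
    (hF : LocallyLipschitz fun q : X × E × E => F q.1 q.2.1 q.2.2) (hF0 : ∀ e ∈ D, F e 0 0 = 0) :
    ∃ L r : ℝ, 0 < L ∧ 0 < r ∧ ∀ (a b : ℝ) (d : ℝ → X) (w w' : ℝ → E), SampledArc D F a b d w w' →
      b - a ≤ r → w a ∈ S → ∀ t ∈ Icc a b,
        (∀ s ∈ Icc a b, ‖w s - w a‖ ≤ L * (b - a) * ‖w t‖) ∧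
        ∀ e ∈ D, ‖F e (w t) (w a) - F e (w t) (w t)‖ ≤ L * (b - a) * ‖w t‖ := by
  obtain ⟨B, hB0, hB⟩ : ∃ B : ℝ, 0 < B ∧ ∀ v ∈ S, ‖v‖ ≤ B := by
    obtain ⟨B, hB⟩ := hS.isBounded.exists_norm_le
    exact ⟨max B 1, by positivity, fun v hv => (hB v hv).trans (le_max_left _ _)⟩
  set K : Set (X × E × E) := D ×ˢ (Metric.closedBall 0 (B + 1) ×ˢ Metric.closedBall 0 (B + 1))
    with hK
  have hKc : IsCompact K :=
    hD.prod ((isCompact_closedBall _ _).prod (isCompact_closedBall _ _))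
  obtain ⟨N, hN⟩ := (hF.locallyLipschitzOn (s := K)).exists_lipschitzOnWith_of_compact hKc
  have hmem : ∀ e ∈ D, ∀ v v' : E, ‖v‖ ≤ B + 1 → ‖v'‖ ≤ B + 1 → (e, v, v') ∈ K := by
    intro e he v v' hv hv'
    simp [hK, he, hv, hv']
  set L₁ : ℝ := N + 1 with hL₁
  have hN0 : (0:ℝ) ≤ N := N.2
  have hLip : ∀ e ∈ D, ∀ v v' u u' : E, ‖v‖ ≤ B + 1 → ‖v'‖ ≤ B + 1 → ‖u‖ ≤ B + 1 → ‖u'‖ ≤ B + 1 →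
      ‖F e v v' - F e u u'‖ ≤ L₁ * max ‖v - u‖ ‖v' - u'‖ := by
    intro e he v v' u u' hv hv' hu hu'
    have := hN.dist_le_mul _ (hmem e he v v' hv hv') _ (hmem e he u u' hu hu')
    simp only [dist_eq_norm, Prod.norm_def, Prod.fst_sub, Prod.snd_sub, sub_self, norm_zero]
      at this
    rw [max_eq_right (by positivity : (0:ℝ) ≤ max ‖v - u‖ ‖v' - u'‖)] at this
    refine this.trans ?_
    gcongr
    linarith
  have hgrow : ∀ e ∈ D, ∀ v v' : E, ‖v‖ ≤ B + 1 → ‖v'‖ ≤ B + 1 →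
      ‖F e v v'‖ ≤ L₁ * max ‖v‖ ‖v'‖ := by
    intro e he v v' hv hv'
    have h0 : ‖(0:E)‖ ≤ B + 1 := by rw [norm_zero]; linarith
    have := hLip e he v v' 0 0 hv hv' h0 h0
    simpa [hF0 e he] using this
  have hL1 : 1 ≤ L₁ := by linarith
  refine ⟨4 * L₁ ^ 2, 1 / (4 * L₁ * (B + 1)), by positivity, by positivity, ?_⟩
  intro a b d w w' h hr hwa t ht
  have hab : 0 ≤ b - a := sub_nonneg.2 h.le
  have hr1 : 4 * L₁ * (B + 1) * (b - a) ≤ 1 := by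
    rw [le_div_iff₀ (by positivity)] at hr
    linarith
  have hr2 : 4 * L₁ * (b - a) ≤ 1 := by
    nlinarith [mul_nonneg (mul_nonneg (by linarith : (0:ℝ) ≤ L₁) hab) hB0.le]
  have hwB := hB _ hwa
  have hbd : ∀ v, ‖v - w a‖ < 1 → ‖v‖ ≤ B + 1 := by
    intro v hv
    have := norm_le_insert' v (w a)
    linarith
  have hone : ∀ s ∈ Icc a b, ‖w s - w a‖ < 1 := by
    refine h.norm_sub_lt_one (C := L₁ * (B + 1)) (by linarith) (by positivity) ?_
    intro v hv e he
    refine (hgrow e he _ _ (hbd v hv) (by linarith)).trans ?_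
    gcongr
    exact max_le (hbd v hv) (by linarith)
  obtain ⟨s₀, hs₀, hmax⟩ := isCompact_Icc.exists_isMaxOn ⟨a, left_mem_Icc.2 h.le⟩
    (h.continuousOn.sub continuousOn_const : ContinuousOn (fun s => w s - w a) (Icc a b)).norm
  set m := ‖w s₀ - w a‖ with hm
  have hmax' : ∀ s ∈ Icc a b, ‖w s - w a‖ ≤ m := fun s hs => hmax hs
  have hm1 : m ≤ L₁ * (‖w t‖ + 2 * m) * (s₀ - a) := by
    refine h.norm_sub_le hs₀ fun s hs e he => ?_
    have hsI : s ∈ Icc a b := ⟨hs.1, hs.2.le.trans hs₀.2⟩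
    refine (hgrow e he _ _ (hbd _ (hone s hsI)) (by linarith)).trans ?_
    have h1 := hmax' s hsI
    have h2 := hmax' t ht
    have h3 := norm_le_insert' (w s) (w a)
    have h4 := norm_le_insert (w t) (w a)
    have h5 : 0 ≤ m := norm_nonneg _
    gcongr
    exact max_le (by linarith) (by linarith)
  have hm0 : 0 ≤ m := norm_nonneg _
  have hwt := norm_nonneg (w t)
  have hm2 : m ≤ L₁ * (‖w t‖ + 2 * m) * (b - a) := by
    refine hm1.trans ?_
    gcongr
    exact hs₀.2
  have hm3 : m ≤ 2 * L₁ * (b - a) * ‖w t‖ := by nlinarith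
  have hp : 0 ≤ L₁ * (b - a) * ‖w t‖ := by positivity
  have hpL : L₁ * (b - a) * ‖w t‖ ≤ L₁ * (L₁ * (b - a) * ‖w t‖) := le_mul_of_one_le_left hp hL1
  refine ⟨fun s hs => (hmax' s hs).trans (hm3.trans ?_), fun e he => ?_⟩
  · nlinarith
  · have h1 := hLip e he (w t) (w a) (w t) (w t) (hbd _ (hone t ht)) (by linarith)
      (hbd _ (hone t ht)) (hbd _ (hone t ht))
    rw [sub_self, norm_zero, max_eq_right (norm_nonneg _), norm_sub_rev (w a)] at h1
    have h2 : L₁ * ‖w t - w a‖ ≤ L₁ * (2 * L₁ * (b - a) * ‖w t‖) := by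
      gcongr
      exact (hmax' t ht).trans hm3
    nlinarith

/-- If `q` strictly decreases along the vector field `v ↦ F e v v` on the part of `S` where `q = ρ`,
then along every arc starting in `S` and staying close to its initial point, `q` stays below its
initial value or below `ρ`. -/
lemma exists_barrier [NormedAddCommGroup X] [ProperSpace E] (hD : IsCompact D) {S : Set E} (hS : IsCompact S)
    (hF : Continuous fun q : X × E × E => F q.1 q.2.1 q.2.2)
    (q : E → ℝ) (Q : E → E → E →L[ℝ] ℝ) (ρ : ℝ) (hq : Continuous q)
    (hQ : Continuous fun v : E × E => Q v.1 v.2)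
    (hQq : ∀ v v', q v' - q v = Q v v' (v' - v)) (hSρ : ∀ v ∈ S, q v ≤ ρ)
    (hneg : ∀ e ∈ D, ∀ v ∈ S, q v = ρ → Q v v (F e v v) < 0) :
    ∃ η : ℝ, 0 < η ∧ ∀ (a b : ℝ) (d : ℝ → X) (w w' : ℝ → E), SampledArc D F a b d w w' →
      w a ∈ S → (∀ s ∈ Icc a b, ‖w s - w a‖ < η) →
        ∀ t ∈ Icc a b, q (w t) ≤ q (w a) ∨ q (w t) < ρ := by
  set Φ : X × E × E × E → ℝ := fun z =>
    Q z.2.1 (z.2.1 + z.2.2.2) (F z.1 (z.2.1 + z.2.2.1) z.2.1) with hΦ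
  have hΦc : Continuous Φ := by
    have h1 : Continuous fun z : X × E × E × E => Q z.2.1 (z.2.1 + z.2.2.2) :=
      hQ.comp (f := fun z : X × E × E × E => (z.2.1, z.2.1 + z.2.2.2)) (by fun_prop)
    have h2 : Continuous fun z : X × E × E × E => F z.1 (z.2.1 + z.2.2.1) z.2.1 :=
      hF.comp (f := fun z : X × E × E × E => (z.1, z.2.1 + z.2.2.1, z.2.1)) (by fun_prop)
    exact h1.clm_apply h2
  have hball := isCompact_closedBall (0 : E) 1
  obtain ⟨η₁, hη₁, h₁⟩ : ∃ η : ℝ, 0 < η ∧ ∀ e ∈ D, ∀ v ∈ S, ∀ u u' : E, ρ - η < q v →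
      ‖u‖ < η → ‖u'‖ < η → Φ (e, v, u, u') < 0 := by
    set Z : Set (X × E × E × E) :=
      (D ×ˢ S ×ˢ Metric.closedBall 0 1 ×ˢ Metric.closedBall 0 1) ∩ Φ ⁻¹' Ici 0 with hZ
    have hZc : IsCompact Z :=
      (hD.prod (hS.prod (hball.prod hball))).inter_right (isClosed_Ici.preimage hΦc)
    set θ : X × E × E × E → ℝ := fun z => max (ρ - q z.2.1) (max ‖z.2.2.1‖ ‖z.2.2.2‖) with hθ
    have hθc : Continuous θ := by fun_prop
    obtain ⟨η, hη, hηZ⟩ : ∃ η : ℝ, 0 < η ∧ ∀ z ∈ Z, η ≤ θ z := by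
      rcases Z.eq_empty_or_nonempty with hemp | hne
      · exact ⟨1, one_pos, by simp [hemp]⟩
      obtain ⟨z, hz, hmin⟩ := hZc.exists_isMinOn hne hθc.continuousOn
      refine ⟨θ z, ?_, fun z' hz' => hmin hz'⟩
      by_contra! hle
      obtain ⟨e, v, u, u'⟩ := z
      simp only [hθ, max_le_iff, norm_le_zero_iff] at hle
      obtain ⟨hv, rfl, rfl⟩ := hle
      have hvS : v ∈ S := hz.1.2.1
      have h0 : (0:ℝ) ≤ Φ (e, v, 0, 0) := hz.2
      have := hneg e hz.1.1 v hvS (le_antisymm (hSρ v hvS) (by linarith))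
      simp only [hΦ, add_zero] at h0
      linarith
    refine ⟨min η 1, by positivity, fun e he v hv u u' hqv hu hu' => ?_⟩
    by_contra! hcon
    have hz : (e, v, u, u') ∈ Z := by
      refine ⟨⟨he, hv, ?_, ?_⟩, hcon⟩
      · simpa using hu.le.trans (min_le_right _ _)
      · simpa using hu'.le.trans (min_le_right _ _)
    have h3 := hηZ _ hz
    have h4 : θ (e, v, u, u') < η := by
      have := min_le_left η 1
      simp only [hθ, max_lt_iff]
      exact ⟨by linarith, by linarith, by linarith⟩
    linarith
  obtain ⟨η₂, hη₂, h₂⟩ : ∃ η : ℝ, 0 < η ∧ ∀ v ∈ S, ∀ u : E, q v ≤ ρ - η₁ → ‖u‖ < η →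
      q (v + u) < ρ := by
    set Z : Set (E × E) := (S ×ˢ Metric.closedBall 0 1) ∩
      {z | q z.1 ≤ ρ - η₁ ∧ ρ ≤ q (z.1 + z.2)} with hZ
    have hZc : IsCompact Z := by
      refine (hS.prod hball).inter_right (IsClosed.inter ?_ ?_)
      · exact isClosed_le (hq.comp continuous_fst) continuous_const
      · exact isClosed_le continuous_const (hq.comp continuous_add)
    obtain ⟨η, hη, hηZ⟩ : ∃ η : ℝ, 0 < η ∧ ∀ z ∈ Z, η ≤ ‖z.2‖ := by
      rcases Z.eq_empty_or_nonempty with hemp | hne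
      · exact ⟨1, one_pos, by simp [hemp]⟩
      obtain ⟨z, hz, hmin⟩ := hZc.exists_isMinOn hne
        (by fun_prop : ContinuousOn (fun z : E × E => ‖z.2‖) Z)
      refine ⟨‖z.2‖, ?_, fun z' hz' => hmin hz'⟩
      rw [norm_pos_iff]
      intro h0
      have h3 := hz.2.1
      have h4 := hz.2.2
      rw [h0, add_zero] at h4
      linarith
    refine ⟨min η 1, by positivity, fun v hv u hqv hu => ?_⟩
    by_contra! hcon
    have := hηZ (v, u) ⟨⟨hv, by simpa using hu.le.trans (min_le_right _ _)⟩, hqv, hcon⟩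
    exact absurd (hu.trans_le (min_le_left _ _)) (not_lt.2 this)
  refine ⟨min η₁ η₂, by positivity, fun a b d w w' h hwa hclose t ht => ?_⟩
  rcases le_or_gt (q (w a)) (ρ - η₁) with hle | hgt
  · right
    have := h₂ (w a) hwa (w t - w a) hle ((hclose t ht).trans_le (min_le_right _ _))
    rwa [add_sub_cancel] at this
  · left
    have h5 : q (w t) - q (w a) = ∫ s in a..t, Q (w a) (w t) (w' s) := by
      rw [hQq, h.eq_integral t ht, add_sub_cancel_left, ← h.eq_integral t ht]
      exact ((Q (w a) (w t)).intervalIntegral_comp_comm (h.integrable_left ht)).symm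
    have h6 : ∫ s in a..t, Q (w a) (w t) (w' s) ≤ 0 := by
      rw [intervalIntegral.integral_of_le ht.1]
      apply integral_nonpos_of_ae
      refine (ae_restrict_iff' measurableSet_Ioc).2 ?_
      filter_upwards [h.ae_eq] with s hs hmem
      have hsI : s ∈ Icc a b := ⟨hmem.1.le, hmem.2.trans ht.2⟩
      have := h₁ (d s) (h.mem s) (w a) hwa (w s - w a) (w t - w a) hgt
        ((hclose s hsI).trans_le (min_le_left _ _)) ((hclose t ht).trans_le (min_le_left _ _))
      simp only [hΦ, add_sub_cancel] at this
      rw [hs ⟨hmem.1, hsI.2⟩]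
      exact this.le
    linarith

end SampledArc

end SampledArcs

section Algebra

variable {m : ℕ}

lemma ip_eq_inner (x y : EuclideanSpace ℝ (Fin m)) : ip x y = inner ℝ x y := by
  simp [ip, PiLp.inner_apply, mul_comm]

lemma ip_eq_dotProduct (x y : EuclideanSpace ℝ (Fin m)) : ip x y = ef x ⬝ᵥ ef y := rfl

lemma mulVecE_eq (N : Matrix (Fin m) (Fin m) ℝ) (x : EuclideanSpace ℝ (Fin m)) :
    mulVecE N x = Matrix.toEuclideanCLM (𝕜 := ℝ) N x := rfl

lemma ip_mulVecE_comm {P : Matrix (Fin m) (Fin m) ℝ} (hP : P.PosDef)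
    (x y : EuclideanSpace ℝ (Fin m)) : ip x (mulVecE P y) = ip y (mulVecE P x) := by
  have h : Pᵀ = P := by simpa using hP.isHermitian.eq
  change ef x ⬝ᵥ P *ᵥ ef y = ef y ⬝ᵥ P *ᵥ ef x
  conv_lhs => rw [← h, mulVec_transpose, ← dotProduct_comm, ← dotProduct_mulVec]

lemma qf_pos {P : Matrix (Fin m) (Fin m) ℝ} (hP : P.PosDef) {x : EuclideanSpace ℝ (Fin m)}
    (hx : x ≠ 0) : 0 < qf P x := by
  have hx' : ef x ≠ 0 := fun h => hx (by ext i; exact congrFun h i)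
  have h := hP.dotProduct_mulVec_pos hx'
  rwa [star_trivial] at h

lemma qf_smul (P : Matrix (Fin m) (Fin m) ℝ) (a : ℝ) (x : EuclideanSpace ℝ (Fin m)) :
    qf P (a • x) = a ^ 2 * qf P x := by
  simp only [qf, ip_eq_inner, mulVecE_eq, map_smul, inner_smul_left, inner_smul_right]
  simp
  ring

lemma continuous_qf (P : Matrix (Fin m) (Fin m) ℝ) : Continuous (qf P) := by
  have h : qf P = fun x => inner ℝ x (Matrix.toEuclideanCLM (𝕜 := ℝ) P x) := by
    funext x; rw [qf, ip_eq_inner, mulVecE_eq]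
  rw [h]
  fun_prop

lemma exists_mul_norm_sq_le_qf {P : Matrix (Fin m) (Fin m) ℝ} (hP : P.PosDef) :
    ∃ lam : ℝ, 0 < lam ∧ ∀ x : EuclideanSpace ℝ (Fin m), lam * ‖x‖ ^ 2 ≤ qf P x := by
  obtain ⟨lam, hlam, h⟩ : ∃ lam : ℝ, 0 < lam ∧
      ∀ x ∈ Metric.sphere (0 : EuclideanSpace ℝ (Fin m)) 1, lam ≤ qf P x := by
    rcases (Metric.sphere (0 : EuclideanSpace ℝ (Fin m)) 1).eq_empty_or_nonempty with he | hne
    · exact ⟨1, one_pos, by simp [he]⟩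
    obtain ⟨x, hx, hmin⟩ :=
      (isCompact_sphere (0 : EuclideanSpace ℝ (Fin m)) 1).exists_isMinOn hne
        (continuous_qf P).continuousOn
    refine ⟨qf P x, qf_pos hP ?_, fun y hy => hmin hy⟩
    rintro rfl
    simp at hx
  refine ⟨lam, hlam, fun x => ?_⟩
  rcases eq_or_ne x 0 with rfl | hx
  · simpa using (qf_smul P 0 0).ge
  have hn : ‖x‖ ≠ 0 := norm_ne_zero_iff.2 hx
  have h1 := h (‖x‖⁻¹ • x) (by simp [norm_smul, hn])
  rw [qf_smul, inv_pow] at h1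
  have h2 : 0 < ‖x‖ ^ 2 := by positivity
  calc lam * ‖x‖ ^ 2 ≤ (‖x‖ ^ 2)⁻¹ * qf P x * ‖x‖ ^ 2 := by gcongr
    _ = qf P x := by field_simp

/-- The Lyapunov inequality for `A + bp'` makes its transpose invertible. -/
lemma isUnit_det_of_posDef {P N : Matrix (Fin m) (Fin m) ℝ} (h : (-(P * Nᵀ + N * P)).PosDef) :
    IsUnit N.det := by
  rw [isUnit_iff_ne_zero, ← det_transpose]
  intro h0
  obtain ⟨v, hv, hNv⟩ := Matrix.exists_mulVec_eq_zero_iff.2 h0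
  have h1 := h.dotProduct_mulVec_pos hv
  rw [neg_mulVec, add_mulVec, ← mulVec_mulVec, ← mulVec_mulVec, hNv, mulVec_zero, zero_add,
    dotProduct_neg, dotProduct_mulVec, star_trivial, ← mulVec_transpose, hNv,
    zero_dotProduct] at h1
  simp at h1

lemma ip_cvec_matA {n : ℕ} {p : EuclideanSpace ℝ (Fin (n + 1))}
    (h : IsUnit ((matA (n + 1))ᵀ + vecMulVec (ef p) (vecbf (n + 1))).det)
    (x : EuclideanSpace ℝ (Fin (n + 1))) :
    ip (cvec n p) (mulVecE (matA (n + 1)) x)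
      = -x (Fin.last n) - ip (cvec n p) (vecb (n + 1)) * ip p x := by
  set N := (matA (n + 1))ᵀ + vecMulVec (ef p) (vecbf (n + 1)) with hN
  have h1 : N *ᵥ ef (cvec n p) = -Pi.single (Fin.last n) 1 := by
    change N *ᵥ (-(N⁻¹ *ᵥ Pi.single (Fin.last n) 1)) = _
    rw [mulVec_neg, mulVec_mulVec, mul_nonsing_inv _ h, one_mulVec]
  have h2 := congrArg (fun v => v ⬝ᵥ ef x) h1
  simp only [hN, add_mulVec, add_dotProduct, neg_dotProduct, single_one_dotProduct,
    mulVec_transpose, ← dotProduct_mulVec, vecMulVec_mulVec, smul_dotProduct] at h2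
  have h3 : ip (cvec n p) (vecb (n + 1)) = vecbf (n + 1) ⬝ᵥ ef (cvec n p) := dotProduct_comm _ _
  have h4 : ip p x = ef p ⬝ᵥ ef x := rfl
  have h5 : ip (cvec n p) (mulVecE (matA (n + 1)) x) = ef (cvec n p) ⬝ᵥ matA (n + 1) *ᵥ ef x := rfl
  have h6 : ef x (Fin.last n) = x (Fin.last n) := rfl
  simp at h2
  rw [h3, h4, h5, ← h6]
  linarith

lemma mulVecE_vecMulVec (p x : EuclideanSpace ℝ (Fin m)) :
    mulVecE (vecMulVec (vecbf m) (ef p)) x = ip p x • vecb m := by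
  ext i
  simp [mulVecE, vecMulVec_mulVec, vecb, ip_eq_dotProduct]

lemma mulVecE_add_left (N N' : Matrix (Fin m) (Fin m) ℝ) (x : EuclideanSpace ℝ (Fin m)) :
    mulVecE (N + N') x = mulVecE N x + mulVecE N' x := by
  simp only [mulVecE_eq, map_add, _root_.add_apply]

lemma mulVecE_smul_one (a : ℝ) (x : EuclideanSpace ℝ (Fin m)) :
    mulVecE (a • (1 : Matrix (Fin m) (Fin m) ℝ)) x = a • x := by
  simp [mulVecE_eq]

end Algebra

section ClosedLoop

variable {l n : ℕ}

/-- The unsaturated feedback `u = p'x - K c'b ω z` in the coordinates `(x, z) = (x, y + c'x)`. -/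
def linFeedback (p : EuclideanSpace ℝ (Fin (n + 1))) (K ω : ℝ)
    (v : EuclideanSpace ℝ (Fin (n + 1)) × ℝ) : ℝ :=
  ip p v.1 - K * ip (cvec n p) (vecb (n + 1)) * ω * v.2

/-- The closed-loop vector field in the coordinates `(x, z) = (x, y + c'x)`, at the state `v`, with
the unsaturated feedback evaluated at the sampled state `v'`. -/
def loopField
    (f : EuclideanSpace ℝ (Fin l) → EuclideanSpace ℝ (Fin (n+1)) → ℝ → EuclideanSpace ℝ (Fin (n+1)))
    (g : EuclideanSpace ℝ (Fin l) → EuclideanSpace ℝ (Fin (n+1)) → ℝ → ℝ)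
    (p : EuclideanSpace ℝ (Fin (n + 1))) (K ω : ℝ) (e : EuclideanSpace ℝ (Fin l))
    (v v' : EuclideanSpace ℝ (Fin (n + 1)) × ℝ) : EuclideanSpace ℝ (Fin (n + 1)) × ℝ :=
  (mulVecE (matA (n + 1)) v.1 + f e v.1 (linFeedback p K ω v')
      + linFeedback p K ω v' • vecb (n + 1),
    g e v.1 (linFeedback p K ω v') + ip (cvec n p) (f e v.1 (linFeedback p K ω v'))
      + ip (cvec n p) (vecb (n + 1)) * (linFeedback p K ω v' - ip p v.1))

/-- The derivative of `(M/2) z² + (1/2) x'Px` at `v = (x, z)`. -/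
def lyapDeriv (P : Matrix (Fin (n + 1)) (Fin (n + 1)) ℝ) (M : ℝ)
    (v : EuclideanSpace ℝ (Fin (n + 1)) × ℝ) : EuclideanSpace ℝ (Fin (n + 1)) × ℝ →L[ℝ] ℝ :=
  (M * v.2) • ContinuousLinearMap.snd ℝ _ _ +
    ((innerSL ℝ v.1).comp (Matrix.toEuclideanCLM (𝕜 := ℝ) P)).comp
      (ContinuousLinearMap.fst ℝ _ _)

lemma lyapDeriv_apply (P : Matrix (Fin (n + 1)) (Fin (n + 1)) ℝ) (M : ℝ)
    (v ξ : EuclideanSpace ℝ (Fin (n + 1)) × ℝ) :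
    lyapDeriv P M v ξ = M * v.2 * ξ.2 + ip v.1 (mulVecE P ξ.1) := by
  simp [lyapDeriv, ip_eq_inner, mulVecE_eq]

lemma exists_norm_lyapDeriv_le (P : Matrix (Fin (n + 1)) (Fin (n + 1)) ℝ) (M : ℝ) :
    ∃ C : ℝ, 0 < C ∧ ∀ v ξ, |lyapDeriv P M v ξ| ≤ C * ‖v‖ * ‖ξ‖ := by
  set T := Matrix.toEuclideanCLM (𝕜 := ℝ) P
  refine ⟨|M| + ‖T‖ + 1, by positivity, fun v ξ => ?_⟩
  have h1 : |M * v.2 * ξ.2| ≤ |M| * ‖v‖ * ‖ξ‖ := by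
    rw [abs_mul, abs_mul]
    gcongr
    · exact norm_snd_le v
    · exact norm_snd_le ξ
  have h2 : |ip v.1 (mulVecE P ξ.1)| ≤ ‖T‖ * ‖v‖ * ‖ξ‖ := by
    rw [ip_eq_inner, mulVecE_eq]
    calc _ ≤ ‖v.1‖ * ‖T ξ.1‖ := abs_real_inner_le_norm _ _
      _ ≤ ‖v‖ * (‖T‖ * ‖ξ‖) := by
        gcongr
        · exact norm_fst_le v
        · exact (T.le_opNorm _).trans (by gcongr; exact norm_fst_le ξ)
      _ = ‖T‖ * ‖v‖ * ‖ξ‖ := by ring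
  rw [lyapDeriv_apply]
  have h3 : 0 ≤ ‖v‖ * ‖ξ‖ := by positivity
  have h4 := abs_add_le (M * v.2 * ξ.2) (ip v.1 (mulVecE P ξ.1))
  nlinarith

lemma hasDerivAt_lyap {P : Matrix (Fin (n + 1)) (Fin (n + 1)) ℝ} (hP : P.PosDef) (M : ℝ)
    {w : ℝ → EuclideanSpace ℝ (Fin (n + 1)) × ℝ} {ξ : EuclideanSpace ℝ (Fin (n + 1)) × ℝ} {t : ℝ}
    (hw : HasDerivAt w ξ t) :
    HasDerivAt (fun s => M / 2 * (w s).2 ^ 2 + 1 / 2 * qf P (w s).1) (lyapDeriv P M (w t) ξ) t := by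
  have h1 : HasDerivAt (fun s => (w s).1) ξ.1 t := hw.fst
  have h2 : HasDerivAt (fun s => (w s).2) ξ.2 t := hw.snd
  have h3 := h1.inner ℝ ((Matrix.toEuclideanCLM (𝕜 := ℝ) P).hasFDerivAt.comp_hasDerivAt t h1)
  have h4 := ((h2.pow 2).const_mul (M / 2)).add (h3.const_mul (1 / 2))
  have h5 := ip_mulVecE_comm hP ξ.1 (w t).1
  rw [ip_eq_inner, ip_eq_inner, mulVecE_eq, mulVecE_eq] at h5
  convert! h4 using 1
  · funext s
    simp [qf, ip_eq_inner, mulVecE_eq]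
  · rw [lyapDeriv_apply, ip_eq_inner, mulVecE_eq]
    simp only [Function.comp_apply, h5]
    simp
    ring

variable {D : Set (EuclideanSpace ℝ (Fin l))}
  {f : EuclideanSpace ℝ (Fin l) → EuclideanSpace ℝ (Fin (n+1)) → ℝ → EuclideanSpace ℝ (Fin (n+1))}
  {g : EuclideanSpace ℝ (Fin l) → EuclideanSpace ℝ (Fin (n+1)) → ℝ → ℝ}
  {P : Matrix (Fin (n+1)) (Fin (n+1)) ℝ} {p : EuclideanSpace ℝ (Fin (n+1))} {M R K ω δ : ℝ}

lemma locallyLipschitz_ip (c : EuclideanSpace ℝ (Fin (n + 1))) : LocallyLipschitz (ip c) := by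
  have h : ip c = innerSL ℝ c := by funext x; rw [ip_eq_inner, innerSL_apply_apply]
  rw [h]
  exact (innerSL ℝ c).lipschitz.locallyLipschitz

lemma locallyLipschitz_linFeedback (p : EuclideanSpace ℝ (Fin (n + 1))) (K ω : ℝ) :
    LocallyLipschitz (linFeedback p K ω) := by
  have h : ContDiff ℝ 1 fun v : EuclideanSpace ℝ (Fin (n + 1)) × ℝ =>
      innerSL ℝ p v.1 - K * ip (cvec n p) (vecb (n + 1)) * ω * v.2 := by fun_prop
  have h' : linFeedback p K ω = fun v => innerSL ℝ p v.1 -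
      K * ip (cvec n p) (vecb (n + 1)) * ω * v.2 := by
    funext v; rw [linFeedback, ip_eq_inner, innerSL_apply_apply]
  rw [h']
  exact h.locallyLipschitz

lemma locallyLipschitz_loopField
    (hf : LocallyLipschitz
      (fun q : EuclideanSpace ℝ (Fin l) × EuclideanSpace ℝ (Fin (n+1)) × ℝ => f q.1 q.2.1 q.2.2))
    (hg : LocallyLipschitz
      (fun q : EuclideanSpace ℝ (Fin l) × EuclideanSpace ℝ (Fin (n+1)) × ℝ => g q.1 q.2.1 q.2.2))
    (p : EuclideanSpace ℝ (Fin (n + 1))) (K ω : ℝ) :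
    LocallyLipschitz fun q : EuclideanSpace ℝ (Fin l) ×
      (EuclideanSpace ℝ (Fin (n + 1)) × ℝ) × (EuclideanSpace ℝ (Fin (n + 1)) × ℝ) =>
        loopField f g p K ω q.1 q.2.1 q.2.2 := by
  have hu : LocallyLipschitz fun q : EuclideanSpace ℝ (Fin l) ×
      (EuclideanSpace ℝ (Fin (n + 1)) × ℝ) × (EuclideanSpace ℝ (Fin (n + 1)) × ℝ) =>
        linFeedback p K ω q.2.2 :=
    (locallyLipschitz_linFeedback p K ω).comp
      (LipschitzWith.prod_snd.comp LipschitzWith.prod_snd).locallyLipschitz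
  have hx : LocallyLipschitz fun q : EuclideanSpace ℝ (Fin l) ×
      (EuclideanSpace ℝ (Fin (n + 1)) × ℝ) × (EuclideanSpace ℝ (Fin (n + 1)) × ℝ) => q.2.1.1 :=
    (LipschitzWith.prod_fst.comp
      (LipschitzWith.prod_fst.comp LipschitzWith.prod_snd)).locallyLipschitz
  have harg := LipschitzWith.prod_fst.locallyLipschitz (α := EuclideanSpace ℝ (Fin l) ×
      (EuclideanSpace ℝ (Fin (n + 1)) × ℝ) × (EuclideanSpace ℝ (Fin (n + 1)) × ℝ))
      |>.prodMk (hx.prodMk hu)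
  have hf' := hf.comp harg
  have hg' := hg.comp harg
  have hA := (Matrix.toEuclideanCLM (𝕜 := ℝ) (matA (n + 1))).lipschitz.locallyLipschitz.comp hx
  have hb := (ContinuousLinearMap.toSpanSingleton ℝ
    (vecb (n + 1))).lipschitz.locallyLipschitz.comp hu
  have hc := (locallyLipschitz_ip (cvec n p)).comp hf'
  have hp := (locallyLipschitz_ip p).comp hx
  have hβ := (ContinuousLinearMap.toSpanSingleton ℝ
    (ip (cvec n p) (vecb (n + 1)))).lipschitz.locallyLipschitz.comp (hu.sub hp)
  convert! ((hA.add hf').add hb).prodMk ((hg'.add hc).add hβ) using 3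
  simp [loopField, mulVecE_eq, mul_comm]

lemma loopField_zero (hf0 : ∀ d ∈ D, f d 0 0 = 0) (hg0 : ∀ d ∈ D, g d 0 0 = 0)
    {e : EuclideanSpace ℝ (Fin l)} (he : e ∈ D) : loopField f g p K ω e 0 0 = 0 := by
  have h0 : linFeedback p K ω 0 = 0 := by simp [linFeedback, ip]
  simp [loopField, h0, hf0 e he, hg0 e he, mulVecE_eq, ip]

/-- The region `x'Px ≤ R²`, `ω|z| ≤ 1`. -/
def invRegion (P : Matrix (Fin (n+1)) (Fin (n+1)) ℝ) (R ω : ℝ) :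
    Set (EuclideanSpace ℝ (Fin (n + 1)) × ℝ) :=
  {v | qf P v.1 ≤ R ^ 2 ∧ |v.2| ≤ ω⁻¹}

lemma isCompact_invRegion (hP : P.PosDef) (R ω : ℝ) : IsCompact (invRegion P R ω) := by
  obtain ⟨lam, hlam, h⟩ := exists_mul_norm_sq_le_qf hP
  have h1 : IsCompact {x | qf P x ≤ R ^ 2} := by
    refine Metric.isCompact_of_isClosed_isBounded
      (isClosed_le (continuous_qf P) continuous_const) ?_
    refine (Metric.isBounded_iff_subset_closedBall 0).2 ⟨√(R ^ 2 / lam), fun x hx => ?_⟩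
    rw [mem_closedBall_zero_iff]
    apply Real.le_sqrt_of_sq_le
    rw [le_div_iff₀ hlam]
    have := h x
    have hx' : qf P x ≤ R ^ 2 := hx
    linarith
  have h2 := h1.prod (isCompact_Icc (a := -ω⁻¹) (b := ω⁻¹))
  have h3 : invRegion P R ω = {x | qf P x ≤ R ^ 2} ×ˢ Icc (-ω⁻¹) ω⁻¹ := by
    ext v; simp [invRegion, abs_le]
  rwa [h3]

lemma abs_linFeedback_sub_le (hK : 0 < K) (hω : 0 < ω)
    {v : EuclideanSpace ℝ (Fin (n + 1)) × ℝ} (hv : |v.2| ≤ ω⁻¹) :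
    |linFeedback p K ω v - ip p v.1| ≤ K * |ip (cvec n p) (vecb (n + 1))| := by
  have h : ω * |v.2| ≤ 1 := by rwa [← le_div_iff₀' hω, one_div]
  rw [linFeedback, sub_sub_cancel_left, abs_neg, abs_mul, abs_mul, abs_mul, abs_of_pos hK,
    abs_of_pos hω, mul_assoc]
  exact mul_le_of_le_one_right (by positivity) h

lemma lyapDeriv_loopField_le (hP : P.PosDef) (hω : 0 < ω) (h35 : Cond35 D f g P p M R K ω δ)
    {e : EuclideanSpace ℝ (Fin l)} (he : e ∈ D) {v : EuclideanSpace ℝ (Fin (n + 1)) × ℝ}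
    (hv : v ∈ invRegion P R ω) :
    lyapDeriv P M v (loopField f g p K ω e v v) ≤ -δ * (v.2 ^ 2 + qf P v.1) := by
  have h : ω * |v.2| ≤ 1 := by rw [← le_div_iff₀' hω, one_div]; exact hv.2
  have h1 := h35 e he v.1 v.2 hv.1 h (linFeedback p K ω v) rfl
  rw [ip_mulVecE_comm hP (vecb (n + 1)), mulVecE_add_left, mulVecE_add_left, mulVecE_vecMulVec,
    mulVecE_smul_one] at h1
  rw [lyapDeriv_apply]
  simp only [loopField, qf]
  set u := linFeedback p K ω v with hu
  have hu' : u = ip p v.1 - K * ip (cvec n p) (vecb (n + 1)) * ω * v.2 := rfl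
  simp only [ip_eq_inner, mulVecE_eq, map_add, map_smul, inner_add_right,
    inner_smul_right] at h1 ⊢
  rw [ip_eq_inner, ip_eq_inner] at hu'
  rw [hu'] at h1 ⊢
  linear_combination h1

/-- Uniform decrease of the Lyapunov function over short sampling intervals, together with
invariance of the region `x'Px < R²`, `ω|z| ≤ 1`. -/
lemma exists_uniform_decrease (hDc : IsCompact D)
    (hfLip : LocallyLipschitz
      (fun q : EuclideanSpace ℝ (Fin l) × EuclideanSpace ℝ (Fin (n+1)) × ℝ => f q.1 q.2.1 q.2.2))
    (hgLip : LocallyLipschitz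
      (fun q : EuclideanSpace ℝ (Fin l) × EuclideanSpace ℝ (Fin (n+1)) × ℝ => g q.1 q.2.1 q.2.2))
    (hf0 : ∀ d ∈ D, f d 0 0 = 0) (hg0 : ∀ d ∈ D, g d 0 0 = 0) (hP : P.PosDef)
    (hM : 0 < M) (hK : 0 < K) (hω : 0 < ω) (hδ : 0 < δ)
    (h33 : Cond33 D f P p R K) (h34 : Cond34 D f g P p R K) (h35 : Cond35 D f g P p M R K ω δ) :
    ∃ r : ℝ, 0 < r ∧ ∃ μ : ℝ, 0 < μ ∧
      ∀ (a b : ℝ) (d : ℝ → EuclideanSpace ℝ (Fin l))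
        (w w' : ℝ → EuclideanSpace ℝ (Fin (n + 1)) × ℝ),
        SampledArc D (loopField f g p K ω) a b d w w' → b - a ≤ r →
        qf P (w a).1 < R ^ 2 → |(w a).2| ≤ ω⁻¹ → ∀ t ∈ Icc a b,
          qf P (w t).1 < R ^ 2 ∧ |(w t).2| ≤ ω⁻¹ ∧
          ∀ e ∈ D, lyapDeriv P M (w t) (loopField f g p K ω e (w t) (w a))
            ≤ -μ * (M / 2 * (w t).2 ^ 2 + 1 / 2 * qf P (w t).1) := by
  set F := loopField f g p K ω with hFdef
  have hF : LocallyLipschitz fun q : EuclideanSpace ℝ (Fin l) ×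
      (EuclideanSpace ℝ (Fin (n + 1)) × ℝ) × (EuclideanSpace ℝ (Fin (n + 1)) × ℝ) =>
        F q.1 q.2.1 q.2.2 := locallyLipschitz_loopField hfLip hgLip p K ω
  set S := invRegion P R ω with hSdef
  have hS : IsCompact S := isCompact_invRegion hP R ω
  obtain ⟨L, r₀, hL, hr₀, hmove⟩ := SampledArc.exists_norm_sub_le hDc hS hF
    (fun e he => loopField_zero hf0 hg0 he)
  set T := Matrix.toEuclideanCLM (𝕜 := ℝ) P with hT
  obtain ⟨η₁, hη₁, hbar₁⟩ := SampledArc.exists_barrier hDc hS hF.continuous (fun v => qf P v.1)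
    (fun v v' => ((innerSL ℝ (v.1 + v'.1)).comp T).comp (ContinuousLinearMap.fst ℝ _ _)) (R ^ 2)
    ((continuous_qf P).comp continuous_fst) (by fun_prop)
    (fun v v' => by
      have h1 := ip_mulVecE_comm hP v.1 v'.1
      simp only [qf, ip_eq_inner, mulVecE_eq] at h1 ⊢
      simp [inner_sub_right, ← hT]
      rw [← hT] at h1
      linarith)
    (fun v hv => hv.1)
    (fun e he v hv hvR => by
      have h1 := h33 e he v.1 (linFeedback p K ω v) hvR (abs_linFeedback_sub_le hK hω hv.2)
      rw [ip_eq_inner, mulVecE_eq] at h1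
      simp only [ContinuousLinearMap.comp_apply, ContinuousLinearMap.coe_fst', innerSL_apply_apply,
        inner_add_left]
      change inner ℝ v.1 (T (F e v v).1) < 0 at h1
      linarith)
  obtain ⟨η₂, hη₂, hbar₂⟩ := SampledArc.exists_barrier hDc hS hF.continuous (fun v => v.2)
    (fun _ _ => ContinuousLinearMap.snd ℝ _ _) ω⁻¹
    continuous_snd continuous_const (fun v v' => by simp)
    (fun v hv => (abs_le.1 hv.2).2)
    (fun e he v hv hvR => by
      have h1 := (abs_lt.1 (h34 e he v.1 (linFeedback p K ω v) hv.1
        (abs_linFeedback_sub_le hK hω hv.2))).2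
      have h2 : linFeedback p K ω v - ip p v.1 = -(K * ip (cvec n p) (vecb (n + 1))) := by
        rw [linFeedback, hvR]; field_simp; ring
      simp only [ContinuousLinearMap.coe_snd', hFdef, loopField, h2]
      linarith)
  obtain ⟨η₃, hη₃, hbar₃⟩ := SampledArc.exists_barrier hDc hS hF.continuous (fun v => -v.2)
    (fun _ _ => -ContinuousLinearMap.snd ℝ _ _) ω⁻¹
    continuous_snd.neg continuous_const (fun v v' => by simp; ring)
    (fun v hv => by have := (abs_le.1 hv.2).1; linarith)
    (fun e he v hv hvR => by
      have h1 := (abs_lt.1 (h34 e he v.1 (linFeedback p K ω v) hv.1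
        (abs_linFeedback_sub_le hK hω hv.2))).1
      have h2 : linFeedback p K ω v - ip p v.1 = K * ip (cvec n p) (vecb (n + 1)) := by
        rw [linFeedback, (by linarith : v.2 = -ω⁻¹)]; field_simp; ring
      simp only [_root_.neg_apply, ContinuousLinearMap.coe_snd', hFdef, loopField, h2]
      linarith)
  obtain ⟨B, hB0, hB⟩ : ∃ B : ℝ, 0 < B ∧ ∀ v ∈ S, ‖v‖ ≤ B := by
    obtain ⟨B, hB⟩ := hS.isBounded.exists_norm_le
    exact ⟨max B 1, by positivity, fun v hv => (hB v hv).trans (le_max_left _ _)⟩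
  obtain ⟨C, hC, hlyap⟩ := exists_norm_lyapDeriv_le P M
  obtain ⟨lam, hlam, hlow⟩ := exists_mul_norm_sq_le_qf hP
  have hnorm : ∀ v : EuclideanSpace ℝ (Fin (n + 1)) × ℝ,
      min lam 1 * ‖v‖ ^ 2 ≤ v.2 ^ 2 + qf P v.1 := by
    intro v
    have h1 := hlow v.1
    have h2 : 0 ≤ lam * ‖v.1‖ ^ 2 := by positivity
    rcases max_choice ‖v.1‖ ‖v.2‖ with h | h <;> rw [Prod.norm_def, h]
    · have : min lam 1 * ‖v.1‖ ^ 2 ≤ lam * ‖v.1‖ ^ 2 := by gcongr; exact min_le_left _ _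
      nlinarith [sq_nonneg v.2]
    · have : min lam 1 * ‖v.2‖ ^ 2 ≤ 1 * ‖v.2‖ ^ 2 := by gcongr; exact min_le_right _ _
      rw [Real.norm_eq_abs, sq_abs] at this ⊢
      linarith
  set lam' := min lam 1 with hlam'
  have hlam'0 : 0 < lam' := by positivity
  set η := min η₁ (min η₂ η₃) with hη
  have hη0 : 0 < η := by positivity
  refine ⟨min r₀ (min (η / (2 * L * B)) (δ * lam' / (2 * C * L))), by positivity,
    δ / max M 1, by positivity, ?_⟩
  intro a b d w w' h hr hwa1 hwa2 t ht
  have hwa : w a ∈ S := ⟨hwa1.le, hwa2⟩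
  have hab : 0 ≤ b - a := sub_nonneg.2 h.le
  have hrr₀ := hr.trans (min_le_left _ _)
  have hr' := hr.trans (min_le_right _ _)
  have hrη := hr'.trans (min_le_left _ _)
  have hrδ := hr'.trans (min_le_right _ _)
  rw [le_div_iff₀ (by positivity)] at hrη hrδ
  have hclose : ∀ s ∈ Icc a b, ‖w s - w a‖ < η := by
    intro s hs
    have h1 := (hmove a b d w w' h hrr₀ hwa a (left_mem_Icc.2 h.le)).1 s hs
    have h2 : L * (b - a) * ‖w a‖ ≤ L * (b - a) * B := by gcongr; exact hB _ hwa
    linarith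
  have h1 := hbar₁ a b d w w' h hwa
    (fun s hs => (hclose s hs).trans_le (min_le_left _ _)) t ht
  have h2 := hbar₂ a b d w w' h hwa
    (fun s hs => (hclose s hs).trans_le ((min_le_right _ _).trans (min_le_left _ _))) t ht
  have h3 := hbar₃ a b d w w' h hwa
    (fun s hs => (hclose s hs).trans_le ((min_le_right _ _).trans (min_le_right _ _))) t ht
  have hq : qf P (w t).1 < R ^ 2 := by rcases h1 with h1 | h1 <;> linarith
  have hz : |(w t).2| ≤ ω⁻¹ := by
    obtain ⟨h4, h5⟩ := abs_le.1 hwa2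
    rw [abs_le]
    constructor
    · rcases h3 with h3 | h3 <;> linarith
    · rcases h2 with h2 | h2 <;> linarith
  refine ⟨hq, hz, fun e he => ?_⟩
  have h4 := lyapDeriv_loopField_le hP hω h35 he (v := w t) ⟨hq.le, hz⟩
  rw [← hFdef] at h4
  have h5 := (hmove a b d w w' h hrr₀ hwa t ht).2 e he
  have h6 := (le_abs_self _).trans (hlyap (w t) (F e (w t) (w a) - F e (w t) (w t)))
  rw [map_sub] at h6
  have h7 : C * ‖w t‖ * ‖F e (w t) (w a) - F e (w t) (w t)‖
      ≤ C * ‖w t‖ * (L * (b - a) * ‖w t‖) := by gcongr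
  have h8 : C * ‖w t‖ * (L * (b - a) * ‖w t‖) ≤ δ / 2 * (lam' * ‖w t‖ ^ 2) := by
    nlinarith [mul_le_mul_of_nonneg_right hrδ (sq_nonneg ‖w t‖)]
  have h9 := mul_le_mul_of_nonneg_left (hnorm (w t)) (by positivity : 0 ≤ δ / 2)
  set W := (w t).2 ^ 2 + qf P (w t).1 with hW
  have hqf0 : 0 ≤ qf P (w t).1 := by
    have := hlow (w t).1
    have : 0 ≤ lam * ‖(w t).1‖ ^ 2 := by positivity
    linarith
  have h10 : M / 2 * (w t).2 ^ 2 + 1 / 2 * qf P (w t).1 ≤ max M 1 / 2 * W := by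
    have ha := mul_le_mul_of_nonneg_right (le_max_left M 1) (sq_nonneg (w t).2)
    have hb := mul_le_mul_of_nonneg_right (le_max_right M 1) hqf0
    rw [hW]
    linarith
  have h11 : δ / max M 1 * (M / 2 * (w t).2 ^ 2 + 1 / 2 * qf P (w t).1)
      ≤ δ / max M 1 * (max M 1 / 2 * W) := by gcongr
  have h12 : δ / max M 1 * (max M 1 / 2 * W) = δ / 2 * W := by
    have : max M 1 ≠ 0 := by positivity
    field_simp
  linarith

end ClosedLoop

/-- **Lemma 3.5.** Under conditions (3.3)–(3.5), for sufficiently small `r̃ > 0` there is a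
`μ > 0` such that along any solution of (3.7) with `x(0)'Px(0) < R²` and
`|y(0) + c'x(0)| ≤ ω⁻¹`, the function `V(t) = (M/2)(y(t)+c'x(t))² + (1/2)x(t)'Px(t)`
satisfies `V̇(t) ≤ -μ V(t)` for almost every `t ≥ 0`. -/
theorem lemma_3_5 (n l : ℕ)
    (D : Set (EuclideanSpace ℝ (Fin l))) (hD : D.Nonempty) (hDc : IsCompact D)
    (f : EuclideanSpace ℝ (Fin l) → EuclideanSpace ℝ (Fin (n+1)) → ℝ → EuclideanSpace ℝ (Fin (n+1)))
    (g : EuclideanSpace ℝ (Fin l) → EuclideanSpace ℝ (Fin (n+1)) → ℝ → ℝ)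
    (hfLip : LocallyLipschitz
      (fun q : EuclideanSpace ℝ (Fin l) × EuclideanSpace ℝ (Fin (n+1)) × ℝ => f q.1 q.2.1 q.2.2))
    (hgLip : LocallyLipschitz
      (fun q : EuclideanSpace ℝ (Fin l) × EuclideanSpace ℝ (Fin (n+1)) × ℝ => g q.1 q.2.1 q.2.2))
    (hf0 : ∀ d ∈ D, f d 0 0 = 0) (hg0 : ∀ d ∈ D, g d 0 0 = 0)
    (P : Matrix (Fin (n+1)) (Fin (n+1)) ℝ) (hP : P.PosDef)
    (p : EuclideanSpace ℝ (Fin (n+1)))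
    (hneg : (-(P * (matA (n+1) + vecMulVec (vecbf (n+1)) (ef p))
        + ((matA (n+1))ᵀ + vecMulVec (ef p) (vecbf (n+1))) * P)).PosDef)
    (M R K ω δ : ℝ) (hM : 0 < M) (hR : 0 < R) (hK : 0 < K) (hω : 0 < ω) (hδ : 0 < δ)
    (h33 : Cond33 D f P p R K) (h34 : Cond34 D f g P p R K)
    (h35 : Cond35 D f g P p M R K ω δ)
    (k : EuclideanSpace ℝ (Fin (n+1)) → ℝ) (hk0 : k 0 = 0)
    (hkb : ∀ C : ℝ, ∃ B : ℝ, ∀ x : EuclideanSpace ℝ (Fin (n+1)), ‖x‖ ≤ C → |k x| ≤ B) :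
    ∃ rt : ℝ, 0 < rt ∧ ∃ μ : ℝ, 0 < μ ∧
      ∀ (τ : ℕ → ℝ) (d : ℝ → EuclideanSpace ℝ (Fin l))
        (x : ℝ → EuclideanSpace ℝ (Fin (n+1))) (y : ℝ → ℝ),
        Sched rt τ → Measurable d → (∀ t : ℝ, d t ∈ D) →
        Sol37 f g (ktilde k P p R K ω) τ d x y →
        qf P (x 0) < R ^ 2 → |y 0 + ip (cvec n p) (x 0)| ≤ ω⁻¹ →
        ∀ᵐ t ∂(volume.restrict (Ici (0:ℝ))), ∀ v : ℝ,
          HasDerivAt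
            (fun s => M / 2 * (y s + ip (cvec n p) (x s)) ^ 2 + 1 / 2 * qf P (x s)) v t →
          v ≤ -μ * (M / 2 * (y t + ip (cvec n p) (x t)) ^ 2 + 1 / 2 * qf P (x t)) := by
  have hdet := isUnit_det_of_posDef (P := P)
    (N := (matA (n+1))ᵀ + vecMulVec (ef p) (vecbf (n+1))) (by
      rw [transpose_add, transpose_transpose, transpose_vecMulVec]
      exact hneg)
  obtain ⟨r, hr, μ, hμ, hstep⟩ :=
    exists_uniform_decrease hDc hfLip hgLip hf0 hg0 hP hM hK hω hδ h33 h34 h35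
  refine ⟨r, hr, μ, hμ, ?_⟩
  rintro τ d x y ⟨hτ0, hτpos, hτr, hτtop⟩ - hd ⟨x', y', hx'int, hy'int, hx, hy, hode⟩ hx0 hy0
  set w : ℝ → EuclideanSpace ℝ (Fin (n + 1)) × ℝ :=
    fun t => (x t, y t + ip (cvec n p) (x t)) with hw
  set w' : ℝ → EuclideanSpace ℝ (Fin (n + 1)) × ℝ :=
    fun t => (x' t, y' t + ip (cvec n p) (x' t)) with hw'
  have hτle : ∀ i, τ i ≤ τ (i + 1) := fun i => by linarith [hτpos i]
  have hτ : ∀ i, 0 ≤ τ i := fun i => hτ0 ▸ monotone_nat_of_le_succ hτle (Nat.zero_le i)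
  have hint : ∀ T, IntervalIntegrable w' volume 0 T ∧
      ∫ s in (0:ℝ)..T, w' s = (∫ s in (0:ℝ)..T, x' s,
        (∫ s in (0:ℝ)..T, y' s) + ip (cvec n p) (∫ s in (0:ℝ)..T, x' s)) := by
    intro T
    have hw'c : w' = fun s => ContinuousLinearMap.inl ℝ _ ℝ (x' s) +
        ContinuousLinearMap.inr ℝ (EuclideanSpace ℝ (Fin (n + 1))) ℝ
          (y' s + innerSL ℝ (cvec n p) (x' s)) := by
      funext s
      simp [hw', ip_eq_inner]
    have h1 := intervalIntegrable_clm_comp (innerSL ℝ (cvec n p)) (hx'int T)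
    have h2 := intervalIntegrable_clm_comp (ContinuousLinearMap.inl ℝ _ ℝ) (hx'int T)
    have h3 := intervalIntegrable_clm_comp
      (ContinuousLinearMap.inr ℝ (EuclideanSpace ℝ (Fin (n + 1))) ℝ) ((hy'int T).add h1)
    rw [hw'c]
    refine ⟨h2.add h3, ?_⟩
    rw [intervalIntegral.integral_add h2 h3,
      ContinuousLinearMap.intervalIntegral_comp_comm _ (hx'int T),
      ContinuousLinearMap.intervalIntegral_comp_comm _ ((hy'int T).add h1),
      intervalIntegral.integral_add (hy'int T) h1,
      ContinuousLinearMap.intervalIntegral_comp_comm _ (hx'int T)]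
    simp [ip_eq_inner]
  have hweq : ∀ t, 0 ≤ t → w t = w 0 + ∫ s in (0:ℝ)..t, w' s := by
    intro t ht
    rw [(hint t).2]
    simp only [hw, Prod.mk_add_mk, Prod.mk.injEq]
    refine ⟨hx t ht, ?_⟩
    rw [hx t ht, hy t ht, ip_eq_inner, ip_eq_inner, ip_eq_inner, inner_add_right]
    ring
  have harc : ∀ i, qf P (w (τ i)).1 < R ^ 2 → |(w (τ i)).2| ≤ ω⁻¹ →
      SampledArc D (loopField f g p K ω) (τ i) (τ (i + 1)) d w w' := by
    intro i hq hz
    have hfb : ktilde k P p R K ω (x (τ i)) (y (τ i)) = linFeedback p K ω (w (τ i)) := by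
      have h1 : |ω * (y (τ i) + ip (cvec n p) (x (τ i)))| ≤ 1 := by
        rw [abs_mul, abs_of_pos hω, ← le_div_iff₀' hω, one_div]
        exact hz
      rw [ktilde, if_neg (not_le.2 hq), sat, max_eq_left h1, div_one, linFeedback]
      ring
    refine ⟨hd, hτle i, (hint _).1.symm.trans (hint _).1, fun t ht => ?_, ?_⟩
    · rw [hweq t ((hτ i).trans ht.1), hweq (τ i) (hτ i), add_assoc,
        intervalIntegral.integral_add_adjacent_intervals (hint _).1
          ((hint _).1.symm.trans (hint _).1)]
    · have h1 := hode i
      rw [Measure.restrict_congr_set (Ico_ae_eq_Ioc (μ := volume)),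
        ae_restrict_iff' measurableSet_Ioc] at h1
      filter_upwards [h1] with t ht htI
      obtain ⟨h2, h3⟩ := ht htI
      rw [hfb] at h2 h3
      have h4 := ip_cvec_matA hdet (x t)
      simp only [ip_eq_inner] at h4
      simp only [hw', loopField, Prod.mk.injEq]
      refine ⟨h2, ?_⟩
      rw [h2, h3]
      simp only [ip_eq_inner, inner_add_right, inner_smul_right]
      rw [h4]
      ring
  have hinv : ∀ i, qf P (w (τ i)).1 < R ^ 2 ∧ |(w (τ i)).2| ≤ ω⁻¹ := by
    intro i
    induction i with
    | zero => rw [hτ0]; exact ⟨hx0, hy0⟩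
    | succ i ih =>
      have := hstep _ _ d w w' (harc i ih.1 ih.2) (hτr i) ih.1 ih.2 _ (right_mem_Icc.2 (hτle i))
      exact ⟨this.1, this.2.1⟩
  have hderiv : ∀ᵐ t : ℝ, 0 < t → HasDerivAt w (w' t) t := by
    have h1 : ∀ᵐ t : ℝ, ∀ N : ℕ, t ∈ uIcc (0:ℝ) N → ∀ c ∈ uIcc (0:ℝ) N,
        HasDerivAt (fun t => ∫ s in c..t, w' s) (w' t) t :=
      ae_all_iff.2 fun N => (hint N).1.ae_hasDerivAt_integral
    filter_upwards [h1] with t ht ht0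
    obtain ⟨N, hN⟩ := exists_nat_ge t
    have h2 := ht N (by rw [uIcc_of_le (ht0.le.trans hN)]; exact ⟨ht0.le, hN⟩) 0 left_mem_uIcc
    refine (h2.const_add (w 0)).congr_of_eventuallyEq ?_
    filter_upwards [Ioi_mem_nhds ht0] with s hs using hweq s (le_of_lt hs)
  have hcover : Ici (0:ℝ) ⊆ ⋃ i, Icc (τ i) (τ (i + 1)) := by
    intro t ht
    have hex : ∃ j, t < τ j := (hτtop.eventually_gt_atTop t).exists
    classical
    have hspec := Nat.find_spec hex
    obtain ⟨i, hi⟩ : ∃ i, Nat.find hex = i + 1 := by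
      refine Nat.exists_eq_succ_of_ne_zero fun h0 => ?_
      rw [h0, hτ0] at hspec
      exact absurd ht (not_le.2 hspec)
    refine mem_iUnion.2 ⟨i, not_lt.1 (Nat.find_min hex (hi ▸ Nat.lt_succ_self i)), ?_⟩
    rw [hi] at hspec
    exact hspec.le
  rw [ae_restrict_iff' measurableSet_Ici]
  have hne : ∀ᵐ t : ℝ, ∀ i, t ≠ τ i := ae_all_iff.2 fun i => by simp [ae_iff, measure_singleton]
  have hae : ∀ᵐ t : ℝ, ∀ i, t ∈ Ioc (τ i) (τ (i + 1)) →
      w' t = loopField f g p K ω (d t) (w t) (w (τ i)) :=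
    ae_all_iff.2 fun i => (harc i (hinv i).1 (hinv i).2).ae_eq
  filter_upwards [hne, hae, hderiv] with t hne hae hderiv ht v hv
  obtain ⟨i, hi⟩ := mem_iUnion.1 (hcover ht)
  have hlt : τ i < t := lt_of_le_of_ne hi.1 (hne i).symm
  have h1 := hasDerivAt_lyap hP M (hderiv ((hτ i).trans_lt hlt))
  rw [hv.unique h1, hae i ⟨hlt, hi.2⟩]
  exact (hstep _ _ d w w' (harc i (hinv i).1 (hinv i).2) (hτr i) (hinv i).1 (hinv i).2 t hi).2.2
    _ (hd t)
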